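/- Let X be a geodesic metric space. For every Morse gauge N there exists a Morse gauge N' such that: if γ₁, γ₂ : [0,∞) → X are N-Morse geodesic rays with γ₁(0) = γ₂(0), x₁ lies on γ₁, x₂ lies on γ₂, and γ is any geodesic from x₁ to x₂, then γ is N'-Morse. -/

import Mathlib

open Set Metric Filter

/-- A map is a geodesic on the interval `I`: distances equal parameter differences. -/
def IsGeodesicOn {X : Type*} [MetricSpace X] (γ : ℝ → X) (I : Set ℝ) : Prop :=
  ∀ s ∈ I, ∀ t ∈ I, dist (γ s) (γ t) = |s - t|

/-- A `(K,C)`-quasigeodesic on the interval `I`. -/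
def IsQuasigeodesicOn {X : Type*} [MetricSpace X] (K C : ℝ) (q : ℝ → X) (I : Set ℝ) : Prop :=
  ∀ s ∈ I, ∀ t ∈ I,
    (1 / K) * |s - t| - C ≤ dist (q s) (q t) ∧ dist (q s) (q t) ≤ K * |s - t| + C

/-- The closed `r`-neighborhood of a subset. -/
def nbhd {X : Type*} [MetricSpace X] (A : Set X) (r : ℝ) : Set X :=
  {x | ∃ y ∈ A, dist x y ≤ r}

/-- A path `γ` (on domain `I`) is `N`-Morse: every `(K,C)`-quasigeodesic with endpoints
on `γ` lies in the `N K C`-neighborhood of `γ`. -/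
def IsMorseOn {X : Type*} [MetricSpace X] (N : ℝ → ℝ → ℝ) (γ : ℝ → X) (I : Set ℝ) : Prop :=
  ∀ K C : ℝ, 1 ≤ K → 0 ≤ C → ∀ (q : ℝ → X) (a b : ℝ), a ≤ b →
    IsQuasigeodesicOn K C q (Icc a b) → q a ∈ γ '' I → q b ∈ γ '' I →
    q '' Icc a b ⊆ nbhd (γ '' I) (N K C)

/-- A Morse gauge takes nonnegative values. -/
def MorseGauge (N : ℝ → ℝ → ℝ) : Prop := ∀ K C : ℝ, 1 ≤ K → 0 ≤ C → 0 ≤ N K C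

/-- A geodesic metric space: any two points are joined by a geodesic. -/
def GeodesicSpace (X : Type*) [MetricSpace X] : Prop :=
  ∀ x y : X, ∃ γ : ℝ → X, IsGeodesicOn γ (Icc 0 (dist x y)) ∧ γ 0 = x ∧ γ (dist x y) = y

/-- A subset is `N`-Morse if quasigeodesics with endpoints on it stay in its neighborhood. -/
def IsMorseSet {X : Type*} [MetricSpace X] (N : ℝ → ℝ → ℝ) (A : Set X) : Prop :=
  ∀ K C : ℝ, 1 ≤ K → 0 ≤ C → ∀ (q : ℝ → X) (a b : ℝ), a ≤ b →
    IsQuasigeodesicOn K C q (Icc a b) → q a ∈ A → q b ∈ A → q '' Icc a b ⊆ nbhd A (N K C)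

section

variable {X : Type*} [MetricSpace X]

theorem nbhd_mono {A B : Set X} {r s : ℝ} (hAB : A ⊆ B) (hrs : r ≤ s) : nbhd A r ⊆ nbhd B s :=
  fun _ ⟨y, hy, h⟩ => ⟨y, hAB hy, h.trans hrs⟩

theorem IsQuasigeodesicOn.mono {K C K' C' : ℝ} {q : ℝ → X} {I J : Set ℝ}
    (h : IsQuasigeodesicOn K C q I) (hJ : J ⊆ I) (hK : 1 ≤ K) (hKK : K ≤ K') (hC : C ≤ C') :
    IsQuasigeodesicOn K' C' q J := by
  intro s hs t ht
  obtain ⟨h₁, h₂⟩ := h s (hJ hs) t (hJ ht)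
  have h₃ : 1 / K' * |s - t| ≤ 1 / K * |s - t| := by gcongr
  have h₄ : K * |s - t| ≤ K' * |s - t| := by gcongr
  constructor <;> linarith

theorem IsQuasigeodesicOn.comp_neg {K C a b : ℝ} {q : ℝ → X}
    (h : IsQuasigeodesicOn K C q (Icc a b)) :
    IsQuasigeodesicOn K C (fun t => q (-t)) (Icc (-b) (-a)) := by
  intro s hs t ht
  have := h (-s) ⟨by linarith [hs.2], by linarith [hs.1]⟩
    (-t) ⟨by linarith [ht.2], by linarith [ht.1]⟩
  rwa [show -s - -t = -(s - t) by ring, abs_neg] at this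

theorem IsGeodesicOn.isQuasigeodesicOn {γ : ℝ → X} {I : Set ℝ} (h : IsGeodesicOn γ I) :
    IsQuasigeodesicOn 1 0 γ I := by
  intro s hs t ht
  rw [h s hs t ht]
  simp

theorem isQuasigeodesicOn_of_lt {K C : ℝ} {q : ℝ → X} {I : Set ℝ} (hC : 0 ≤ C)
    (h : ∀ s ∈ I, ∀ t ∈ I, s < t →
      (1 / K) * (t - s) - C ≤ dist (q s) (q t) ∧ dist (q s) (q t) ≤ K * (t - s) + C) :
    IsQuasigeodesicOn K C q I := by
  intro s hs t ht
  rcases lt_trichotomy s t with hst | rfl | hst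
  · rw [abs_sub_comm, abs_of_pos (sub_pos.2 hst)]
    exact h s hs t ht hst
  · simpa using hC
  · rw [abs_of_pos (sub_pos.2 hst), dist_comm]
    exact h t ht s hs hst

/-- Following a quasigeodesic up to an almost nearest point to `η D`, and then a geodesic `η`,
gives a quasigeodesic. -/
theorem IsQuasigeodesicOn.append {K C a t₀ D : ℝ} {q η : ℝ → X} (hK : 1 ≤ K) (hC : 0 ≤ C)
    (hq : IsQuasigeodesicOn K C q (Icc a t₀)) (hat : a ≤ t₀)
    (hη : IsGeodesicOn η (Icc 0 D)) (hD : 0 ≤ D) (hη₀ : η 0 = q t₀)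
    (hmin : ∀ s ∈ Icc a t₀, D ≤ dist (q s) (η D) + 1) :
    IsQuasigeodesicOn (3 * K) (C + 2) (fun t => if t ≤ t₀ then q t else η (t - t₀))
      (Icc a (t₀ + D)) := by
  refine isQuasigeodesicOn_of_lt (by linarith) fun s hs t ht hst => ?_
  have hK' : 1 / (3 * K) ≤ 1 / K := by gcongr; linarith
  have hK1 : 1 / K ≤ 1 := by rw [div_le_one (by linarith)]; exact hK
  have hst' : 0 ≤ t - s := by linarith
  have hp := mul_le_mul_of_nonneg_right hK' hst'
  have hp1 := mul_le_mul_of_nonneg_right hK1 hst'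
  have hp3 := mul_le_mul_of_nonneg_right hK hst'
  by_cases h₁ : t ≤ t₀
  · have h₂ : s ≤ t₀ := by linarith
    simp only [h₁, h₂, if_true]
    obtain ⟨l, u⟩ := hq s ⟨hs.1, h₂⟩ t ⟨ht.1, h₁⟩
    rw [abs_sub_comm, abs_of_nonneg hst'] at l u
    constructor <;> linarith
  by_cases h₂ : s ≤ t₀
  · simp only [h₁, h₂, if_true, if_false]
    push Not at h₁
    have hr : t - t₀ ∈ Icc 0 D := ⟨by linarith, by linarith [ht.2]⟩
    have hDm : D ∈ Icc 0 D := ⟨hD, le_rfl⟩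
    have d₀ := hη 0 ⟨le_rfl, hD⟩ _ hr
    rw [zero_sub, abs_neg, abs_of_nonneg hr.1, hη₀] at d₀
    have d₁ := hη _ hr D hDm
    rw [abs_sub_comm, abs_of_nonneg (by linarith [hr.2])] at d₁
    obtain ⟨l, u⟩ := hq s ⟨hs.1, h₂⟩ t₀ ⟨hat, le_rfl⟩
    rw [abs_sub_comm, abs_of_nonneg (by linarith)] at l u
    have m := hmin s ⟨hs.1, h₂⟩
    have T₁ := dist_triangle (q s) (η (t - t₀)) (η D)
    have T₂ := dist_triangle_right (q s) (q t₀) (η (t - t₀))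
    have T₃ := dist_triangle (q s) (q t₀) (η (t - t₀))
    have e : 1 / (3 * K) * (t - s) = (1 / K * (t₀ - s) + 1 / K * (t - t₀)) / 3 := by
      field_simp; ring
    have hp2 := mul_le_mul_of_nonneg_right hK1 hr.1
    have hp4 := mul_le_mul_of_nonneg_right hK hr.1
    constructor
    · rw [e]; linarith
    · linarith
  · simp only [h₁, h₂, if_false]
    push Not at h₁ h₂
    rw [hη _ ⟨by linarith, by linarith [hs.2]⟩ _ ⟨by linarith, by linarith [ht.2]⟩,
      abs_sub_comm, abs_of_nonneg (by linarith)]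
    constructor <;> linarith

theorem IsMorseSet.image_left_subset {N : ℝ → ℝ → ℝ} {A : Set X} (hX : GeodesicSpace X)
    (hA : IsMorseSet N A) {K C a t₀ : ℝ} {q : ℝ → X} {y : X} (hK : 1 ≤ K) (hC : 0 ≤ C)
    (hat : a ≤ t₀) (hq : IsQuasigeodesicOn K C q (Icc a t₀)) (hqa : q a ∈ A) (hy : y ∈ A)
    (hmin : ∀ s ∈ Icc a t₀, dist (q t₀) y ≤ dist (q s) y + 1) :
    q '' Icc a t₀ ⊆ nbhd A (N (3 * K) (C + 2)) := by
  obtain ⟨η, hη, hη₀, hη₁⟩ := hX (q t₀) y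
  have hD : 0 ≤ dist (q t₀) y := dist_nonneg
  generalize dist (q t₀) y = D at *
  subst hη₁
  have key := hA (3 * K) (C + 2) (by linarith) (by linarith) _ a (t₀ + D) (by linarith)
    (hq.append hK hC hat hη hD hη₀ hmin) (by simpa [hat] using hqa) (by
      split_ifs with h
      · obtain rfl : D = 0 := by linarith
        simpa [← hη₀] using hy
      · simpa using hy)
  rintro _ ⟨t, ht, rfl⟩
  exact key ⟨t, ⟨ht.1, by linarith [ht.2]⟩, by simp [ht.2]⟩

theorem IsMorseSet.image_right_subset {N : ℝ → ℝ → ℝ} {A : Set X} (hX : GeodesicSpace X)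
    (hA : IsMorseSet N A) {K C b t₀ : ℝ} {q : ℝ → X} {y : X} (hK : 1 ≤ K) (hC : 0 ≤ C)
    (htb : t₀ ≤ b) (hq : IsQuasigeodesicOn K C q (Icc t₀ b)) (hqb : q b ∈ A) (hy : y ∈ A)
    (hmin : ∀ s ∈ Icc t₀ b, dist (q t₀) y ≤ dist (q s) y + 1) :
    q '' Icc t₀ b ⊆ nbhd A (N (3 * K) (C + 2)) := by
  have key := hA.image_left_subset hX hK hC (neg_le_neg htb) hq.comp_neg (by simpa using hqb) hy
    (fun s hs => by simpa using hmin (-s) ⟨by linarith [hs.2], by linarith [hs.1]⟩)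
  rintro _ ⟨t, ht, rfl⟩
  exact key ⟨-t, ⟨by linarith [ht.2], by linarith [ht.1]⟩, by simp⟩

theorem exists_almost_nearest {ι : Type*} {S : Set ι} (hS : S.Nonempty) (q : ι → X) (y : X) :
    ∃ t ∈ S, ∀ s ∈ S, dist (q t) y ≤ dist (q s) y + 1 := by
  have hb : BddBelow ((fun s => dist (q s) y) '' S) := ⟨0, by rintro _ ⟨s, _, rfl⟩; positivity⟩
  obtain ⟨_, ⟨t, ht, rfl⟩, h⟩ :=
    exists_lt_of_csInf_lt (hS.image (fun s => dist (q s) y)) (lt_add_one _)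
  exact ⟨t, ht, fun s hs => h.le.trans (by gcongr; exact csInf_le hb ⟨s, hs, rfl⟩)⟩

theorem IsMorseSet.union {N : ℝ → ℝ → ℝ} {A B : Set X} (hX : GeodesicSpace X)
    (hA : IsMorseSet N A) (hB : IsMorseSet N B) {y : X} (hyA : y ∈ A) (hyB : y ∈ B) :
    IsMorseSet (fun K C => N (3 * K) (C + 2)) (A ∪ B) := by
  intro K C hK hC q a b hab hq ha hb
  obtain ⟨t₀, ht₀, hmin⟩ := exists_almost_nearest (nonempty_Icc.2 hab) q y
  have hl : Icc a t₀ ⊆ Icc a b := Icc_subset_Icc_right ht₀.2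
  have hr : Icc t₀ b ⊆ Icc a b := Icc_subset_Icc_left ht₀.1
  have left : ∀ S ⊆ A ∪ B, IsMorseSet N S → q a ∈ S → y ∈ S →
      q '' Icc a t₀ ⊆ nbhd (A ∪ B) (N (3 * K) (C + 2)) := fun S hS hM h hy =>
    (hM.image_left_subset hX hK hC ht₀.1 (hq.mono hl hK le_rfl le_rfl) h hy
      fun s hs => hmin s (hl hs)).trans (nbhd_mono hS le_rfl)
  have right : ∀ S ⊆ A ∪ B, IsMorseSet N S → q b ∈ S → y ∈ S →
      q '' Icc t₀ b ⊆ nbhd (A ∪ B) (N (3 * K) (C + 2)) := fun S hS hM h hy =>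
    (hM.image_right_subset hX hK hC ht₀.2 (hq.mono hr hK le_rfl le_rfl) h hy
      fun s hs => hmin s (hr hs)).trans (nbhd_mono hS le_rfl)
  rw [← Icc_union_Icc_eq_Icc ht₀.1 ht₀.2, image_union]
  refine union_subset ?_ ?_
  · exact ha.elim (fun h => left A subset_union_left hA h hyA)
      fun h => left B subset_union_right hB h hyB
  · exact hb.elim (fun h => right A subset_union_left hA h hyA)
      fun h => right B subset_union_right hB h hyB

/-- Moving the points of a quasigeodesic by at most `D` costs `2 * D` in the additive
constant. -/
theorem IsQuasigeodesicOn.of_dist_le {K C D : ℝ} {q q' : ℝ → X} {I : Set ℝ}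
    (hq : IsQuasigeodesicOn K C q I) (h : ∀ t ∈ I, dist (q t) (q' t) ≤ D) :
    IsQuasigeodesicOn K (C + 2 * D) q' I := by
  intro s hs t ht
  obtain ⟨l, u⟩ := hq s hs t ht
  have T₂ := dist_triangle4_right (q s) (q t) (q' s) (q' t)
  have T₁ := dist_triangle4_left (q s) (q t) (q' s) (q' t)
  have := h s hs
  have := h t ht
  constructor <;> linarith

theorem IsMorseSet.image_subset_of_mem_nbhd {N : ℝ → ℝ → ℝ} {A : Set X}
    (hA : IsMorseSet N A) {K C D a b : ℝ} {q : ℝ → X} (hK : 1 ≤ K) (hC : 0 ≤ C) (hD : 0 ≤ D)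
    (hab : a ≤ b) (hq : IsQuasigeodesicOn K C q (Icc a b)) (ha : q a ∈ nbhd A D)
    (hb : q b ∈ nbhd A D) : q '' Icc a b ⊆ nbhd A (N K (C + 2 * D) + D) := by
  obtain ⟨x, hxA, hx⟩ := ha
  obtain ⟨y, hyA, hy⟩ := hb
  have hdist : ∀ t, dist (q t) (if t = a then x else if t = b then y else q t) ≤ D := by
    intro t
    split_ifs with h₁ h₂
    · rwa [h₁]
    · rwa [h₂]
    · simpa using hD
  have key := hA K (C + 2 * D) hK (by positivity) _ a b hab (hq.of_dist_le fun t _ => hdist t)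
    (by simpa using hxA) (by
      split_ifs with h₁ h₂
      · exact hxA
      · exact hyA
      · exact absurd rfl h₂)
  rintro _ ⟨t, ht, rfl⟩
  obtain ⟨z, hz, h⟩ := key ⟨t, ht, rfl⟩
  exact ⟨z, hz, (dist_triangle _ _ _).trans (by linarith [hdist t])⟩

/-- A coarse intermediate value theorem. -/
theorem exists_abs_sub_le_of_mem_uIcc {f : ℝ → ℝ} {a b K c v : ℝ} (hK : 0 ≤ K) (hab : a ≤ b)
    (hf : ∀ s ∈ Icc a b, ∀ t ∈ Icc a b, |f s - f t| ≤ K * |s - t| + c)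
    (hv : v ∈ uIcc (f a) (f b)) : ∃ t ∈ Icc a b, |f t - v| ≤ K + c := by
  wlog hle : f a ≤ f b generalizing f v
  · obtain ⟨t, ht, h⟩ := this (f := fun t => -f t) (v := -v)
      (fun s hs t ht => by
        rw [show -f s - -f t = -(f s - f t) by ring, abs_neg]
        exact hf s hs t ht)
      (by
        rw [mem_uIcc] at hv ⊢
        rcases hv with h | h
        · exact Or.inr ⟨by linarith, by linarith⟩
        · exact Or.inl ⟨by linarith, by linarith⟩)
      (by simpa using (not_le.1 hle).le)
    refine ⟨t, ht, ?_⟩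
    rwa [show -f t - -v = -(f t - v) by ring, abs_neg] at h
  rw [uIcc_of_le hle] at hv
  have hS : BddAbove {t ∈ Icc a b | f t ≤ v} := ⟨b, fun t ht => ht.1.2⟩
  obtain ⟨s, ⟨hs, hsv⟩, hs'⟩ :=
    exists_lt_of_lt_csSup (s := {t ∈ Icc a b | f t ≤ v}) ⟨a, left_mem_Icc.2 hab, hv.1⟩
      (sub_one_lt _)
  have hm : min (s + 1) b ∈ Icc a b := ⟨le_min (by linarith [hs.1]) hab, min_le_right _ _⟩
  have hvm : v ≤ f (min (s + 1) b) := by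
    rcases le_total b (s + 1) with h | h
    · rw [min_eq_right h]; exact hv.2
    · by_contra! hlt
      have := le_csSup hS ⟨hm, hlt.le⟩
      rw [min_eq_left h] at this
      linarith
  have h₁ := hf _ hm s hs
  have h₂ : |min (s + 1) b - s| ≤ 1 := by
    rw [abs_of_nonneg (sub_nonneg.2 (le_min (by linarith) hs.2))]
    linarith [min_le_left (s + 1) b]
  have h₃ := mul_le_mul_of_nonneg_left h₂ hK
  have h₄ := le_abs_self (f (min (s + 1) b) - f s)
  exact ⟨s, hs, by rw [abs_sub_comm, abs_of_nonneg (by linarith)]; linarith⟩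

theorem IsQuasigeodesicOn.dist_le_of_dist_le {K C a b E s s' t : ℝ} {q : ℝ → X} (hK : 1 ≤ K)
    (hq : IsQuasigeodesicOn K C q (Icc a b)) (hs : s ∈ Icc a b) (hs' : s' ∈ Icc a b)
    (ht : t ∈ uIcc s s') (hE : dist (q s) (q s') ≤ E) :
    dist (q t) (q s) ≤ K ^ 2 * (E + C) + C := by
  have h₁ := (hq s hs s' hs').1
  have h₂ := (hq t (uIcc_subset_Icc hs hs' ht) s hs).2
  have h₃ : |t - s| ≤ |s - s'| := by
    rw [abs_sub_comm s s']
    exact abs_sub_left_of_mem_uIcc ht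
  have h₄ : |s - s'| ≤ K * (E + C) := by
    have : 1 / K * |s - s'| ≤ E + C := by linarith
    rwa [one_div, inv_mul_le_iff₀ (by linarith)] at this
  have h₅ := mul_le_mul_of_nonneg_left (h₃.trans h₄) (by linarith : 0 ≤ K)
  nlinarith

/-- A quasigeodesic with endpoints on a geodesic segment is close to that segment, if both are close
to a common geodesic. -/
theorem IsQuasigeodesicOn.image_subset_nbhd_of_subset_nbhd {K C R a b c d : ℝ} {q α η : ℝ → X}
    {I : Set ℝ} (hK : 1 ≤ K) (hC : 0 ≤ C) (hR : 0 ≤ R) (hab : a ≤ b)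
    (hq : IsQuasigeodesicOn K C q (Icc a b)) (hα : IsGeodesicOn α I)
    (hη : IsGeodesicOn η (Icc c d)) (ha : q a ∈ η '' Icc c d) (hb : q b ∈ η '' Icc c d)
    (hqα : q '' Icc a b ⊆ nbhd (α '' I) R) (hηα : η '' Icc c d ⊆ nbhd (α '' I) R) :
    q '' Icc a b ⊆ nbhd (η '' Icc c d) (4 * R + 1 + (K ^ 2 * (K + 2 * C + 4 * R) + C)) := by
  have hproj : ∀ x : X, ∃ s : ℝ, x ∈ nbhd (α '' I) R → s ∈ I ∧ dist x (α s) ≤ R := by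
    intro x
    by_cases hx : x ∈ nbhd (α '' I) R
    · obtain ⟨_, ⟨s, hs, rfl⟩, h⟩ := hx
      exact ⟨s, fun _ => ⟨hs, h⟩⟩
    · exact ⟨0, fun h => absurd h hx⟩
  choose π hπ using hproj
  have hπ_le : ∀ x ∈ nbhd (α '' I) R, ∀ y ∈ nbhd (α '' I) R,
      |π x - π y| ≤ dist x y + 2 * R ∧ dist x y ≤ |π x - π y| + 2 * R := by
    intro x hx y hy
    obtain ⟨hxI, hx⟩ := hπ x hx
    obtain ⟨hyI, hy⟩ := hπ y hy
    rw [← hα _ hxI _ hyI]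
    have T₁ := dist_triangle4_left x y (α (π x)) (α (π y))
    have T₂ := dist_triangle4_right x y (α (π x)) (α (π y))
    constructor <;> linarith
  have hqm : ∀ t ∈ Icc a b, q t ∈ nbhd (α '' I) R := fun t ht => hqα ⟨t, ht, rfl⟩
  have hηm : ∀ t ∈ Icc c d, η t ∈ nbhd (α '' I) R := fun t ht => hηα ⟨t, ht, rfl⟩
  have hf : ∀ s ∈ Icc a b, ∀ t ∈ Icc a b,
      |π (q s) - π (q t)| ≤ K * |s - t| + (C + 2 * R) := fun s hs t ht => by
    linarith [(hπ_le _ (hqm s hs) _ (hqm t ht)).1, (hq s hs t ht).2]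
  have hg : ∀ s ∈ Icc c d, ∀ t ∈ Icc c d,
      |π (η s) - π (η t)| ≤ 1 * |s - t| + 2 * R := fun s hs t ht => by
    linarith [(hπ_le _ (hηm s hs) _ (hηm t ht)).1, hη s hs t ht]
  have ham : a ∈ Icc a b := left_mem_Icc.2 hab
  have hbm : b ∈ Icc a b := right_mem_Icc.2 hab
  have hE : 0 ≤ K ^ 2 * (K + 2 * C + 4 * R) + C := by positivity
  have near : ∀ s ∈ Icc a b, ∀ s' ∈ Icc a b, ∀ t ∈ uIcc s s', q s ∈ η '' Icc c d →
      |π (q s') - π (q s)| ≤ K + (C + 2 * R) →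
      q t ∈ nbhd (η '' Icc c d) (4 * R + 1 + (K ^ 2 * (K + 2 * C + 4 * R) + C)) := by
    intro s hs s' hs' t ht hsη h
    refine ⟨q s, hsη, ?_⟩
    have h₁ := (hπ_le _ (hqm s hs) _ (hqm s' hs')).2
    rw [abs_sub_comm] at h₁
    have h₂ := hq.dist_le_of_dist_le hK hs hs' ht (E := K + C + 4 * R) (by linarith)
    rw [show K + C + 4 * R + C = K + 2 * C + 4 * R by ring] at h₂
    linarith
  rintro _ ⟨t, ht, rfl⟩
  have hmedian : π (q t) ∈ uIcc (π (q a)) (π (q b)) ∨ π (q a) ∈ uIcc (π (q t)) (π (q b)) ∨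
      π (q b) ∈ uIcc (π (q a)) (π (q t)) := by
    simp only [mem_uIcc]
    grind
  rcases hmedian with h | h | h
  · obtain ⟨r, hr, hra⟩ := ha
    obtain ⟨r', hr', hrb⟩ := hb
    have hex : ∃ u ∈ Icc c d, |π (η u) - π (q t)| ≤ 1 + 2 * R := by
      rw [← hra, ← hrb] at h
      rcases le_total r r' with hrr | hrr
      · have hsub : Icc r r' ⊆ Icc c d := Icc_subset_Icc hr.1 hr'.2
        obtain ⟨u, hu, h⟩ := exists_abs_sub_le_of_mem_uIcc (f := fun u => π (η u)) zero_le_one hrr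
          (fun s hs t ht => hg s (hsub hs) t (hsub ht)) h
        exact ⟨u, hsub hu, h⟩
      · have hsub : Icc r' r ⊆ Icc c d := Icc_subset_Icc hr'.1 hr.2
        rw [uIcc_comm] at h
        obtain ⟨u, hu, h⟩ := exists_abs_sub_le_of_mem_uIcc (f := fun u => π (η u)) zero_le_one hrr
          (fun s hs t ht => hg s (hsub hs) t (hsub ht)) h
        exact ⟨u, hsub hu, h⟩
    obtain ⟨u, hu, h⟩ := hex
    refine ⟨η u, ⟨u, hu, rfl⟩, ?_⟩
    have := (hπ_le _ (hηm u hu) _ (hqm t ht)).2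
    rw [dist_comm]
    linarith
  · have hsub : Icc t b ⊆ Icc a b := Icc_subset_Icc_left ht.1
    obtain ⟨u, hu, h⟩ := exists_abs_sub_le_of_mem_uIcc (f := fun u => π (q u)) (by linarith) ht.2
      (fun s hs t ht => hf s (hsub hs) t (hsub ht)) h
    exact near a ham u (hsub hu) t (mem_uIcc.2 (Or.inl ⟨ht.1, hu.1⟩)) ha h
  · have hsub : Icc a t ⊆ Icc a b := Icc_subset_Icc_right ht.2
    obtain ⟨u, hu, h⟩ := exists_abs_sub_le_of_mem_uIcc (f := fun u => π (q u)) (by linarith) ht.1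
      (fun s hs t ht => hf s (hsub hs) t (hsub ht)) h
    exact near b hbm u (hsub hu) t (mem_uIcc.2 (Or.inr ⟨hu.2, ht.2⟩)) hb h

/-- The gauge of a geodesic segment in the `D`-neighborhood of an `N`-Morse geodesic. -/
def segmentGauge (N : ℝ → ℝ → ℝ) (D K C : ℝ) : ℝ :=
  4 * (N K (C + 2 * D) + D) + 1 + (K ^ 2 * (K + 2 * C + 4 * (N K (C + 2 * D) + D)) + C)

theorem segmentGauge_morseGauge {N : ℝ → ℝ → ℝ} (hN : MorseGauge N) {D : ℝ} (hD : 0 ≤ D) :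
    MorseGauge (segmentGauge N D) := by
  intro K C hK hC
  have := hN K (C + 2 * D) hK (by positivity)
  unfold segmentGauge
  positivity

theorem IsMorseSet.segment {N : ℝ → ℝ → ℝ} (hN : MorseGauge N) {α η : ℝ → X} {I : Set ℝ}
    {D c d : ℝ} (hD : 0 ≤ D) (hα : IsGeodesicOn α I) (hM : IsMorseSet N (α '' I))
    (hη : IsGeodesicOn η (Icc c d)) (hηα : η '' Icc c d ⊆ nbhd (α '' I) D) :
    IsMorseSet (segmentGauge N D) (η '' Icc c d) := by
  intro K C hK hC q a b hab hq ha hb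
  have h₀ := hN K (C + 2 * D) hK (by positivity)
  exact hq.image_subset_nbhd_of_subset_nbhd hK hC (by positivity) hab hα hη ha hb
    (hM.image_subset_of_mem_nbhd hK hC hD hab hq (hηα ha) (hηα hb))
    (hηα.trans (nbhd_mono subset_rfl (by linarith)))

end

/-- for every Morse gauge N there is a gauge N' such that any geodesic
joining points on two N-Morse rays from a common basepoint is N'-Morse. -/
theorem stmt2 {X : Type*} [MetricSpace X] (hX : GeodesicSpace X)
    (N : ℝ → ℝ → ℝ) (hN : MorseGauge N) :
    ∃ N' : ℝ → ℝ → ℝ, MorseGauge N' ∧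
      ∀ (γ₁ γ₂ : ℝ → X),
        IsGeodesicOn γ₁ (Ici 0) → IsGeodesicOn γ₂ (Ici 0) →
        IsMorseOn N γ₁ (Ici 0) → IsMorseOn N γ₂ (Ici 0) →
        γ₁ 0 = γ₂ 0 →
        ∀ v₁ ∈ Ici (0:ℝ), ∀ v₂ ∈ Ici (0:ℝ),
        ∀ (γ : ℝ → X) (L : ℝ), L = dist (γ₁ v₁) (γ₂ v₂) →
          IsGeodesicOn γ (Icc 0 L) → γ 0 = γ₁ v₁ → γ L = γ₂ v₂ →
          IsMorseOn N' γ (Icc 0 L) := by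
  have hD : 0 ≤ N (3 * 1) (0 + 2) := hN _ _ (by norm_num) (by norm_num)
  refine ⟨fun K C => segmentGauge N (N (3 * 1) (0 + 2)) (3 * K) (C + 2),
    fun K C hK hC => segmentGauge_morseGauge hN hD _ _ (by linarith) (by linarith), ?_⟩
  intro γ₁ γ₂ hγ₁ hγ₂ hM₁ hM₂ hp v₁ hv₁ v₂ hv₂ γ L hL hγ hγ0 hγL
  have hL0 : 0 ≤ L := hL ▸ dist_nonneg
  obtain ⟨u, hu, hmin⟩ := exists_almost_nearest (nonempty_Icc.2 hL0) γ (γ₁ 0)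
  have hl : Icc 0 u ⊆ Icc 0 L := Icc_subset_Icc_right hu.2
  have hr : Icc u L ⊆ Icc 0 L := Icc_subset_Icc_left hu.1
  have hγl : IsGeodesicOn γ (Icc 0 u) := fun s hs t ht => hγ s (hl hs) t (hl ht)
  have hγr : IsGeodesicOn γ (Icc u L) := fun s hs t ht => hγ s (hr hs) t (hr ht)
  have near₁ := IsMorseSet.image_left_subset (A := γ₁ '' Ici 0) hX hM₁ le_rfl le_rfl hu.1
    hγl.isQuasigeodesicOn ⟨v₁, hv₁, hγ0.symm⟩ ⟨0, self_mem_Ici, rfl⟩ fun s hs => hmin s (hl hs)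
  have near₂ := IsMorseSet.image_right_subset (A := γ₂ '' Ici 0) hX hM₂ le_rfl le_rfl hu.2
    hγr.isQuasigeodesicOn ⟨v₂, hv₂, hγL.symm⟩ ⟨0, self_mem_Ici, hp.symm⟩
    fun s hs => hmin s (hr hs)
  have key := (IsMorseSet.segment hN hD hγ₁ hM₁ hγl near₁).union hX
    (IsMorseSet.segment hN hD hγ₂ hM₂ hγr near₂)
    (mem_image_of_mem γ (right_mem_Icc.2 hu.1)) (mem_image_of_mem γ (left_mem_Icc.2 hu.2))
  rwa [← image_union, Icc_union_Icc_eq_Icc hu.1 hu.2] at key
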